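/- arXiv:1604.05695 — 2 statements merged into one kernel-verified Lean document; each statement's English description precedes it below -/
import Mathlib

section
/- Let G be a gyrogroup. The commutator subgyrogroup G′ is an L-subgyrogroup of G, i.e., gyr[a,h](G′) = G′ for all a∈G and h∈G′. -/
universe u v

/-- A gyrogroup: a groupoid `(G, +)` with a left identity `0`, left inverses `-a`,
gyroautomorphisms `gyr a b` (automorphisms of `(G, +)`) satisfying the left
gyroassociative law, and the left loop property. -/
class Gyrogroup (G : Type u) extends Add G, Zero G, Neg G where
  /-- (G1) left identity -/
  zero_add' : ∀ a : G, 0 + a = a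
  /-- (G2) left inverse -/
  neg_add' : ∀ a : G, -a + a = 0
  /-- (G3) the gyroautomorphisms, as bijections of `G` -/
  gyr : G → G → G ≃ G
  /-- (G3) each `gyr a b` preserves the operation, i.e. is an automorphism -/
  gyr_add' : ∀ a b x y : G, gyr a b (x + y) = gyr a b x + gyr a b y
  /-- (G3) left gyroassociative law -/
  add_gyr_assoc' : ∀ a b c : G, a + (b + c) = (a + b) + gyr a b c
  /-- (G4) left loop property -/
  left_loop' : ∀ a b : G, gyr (a + b) b = gyr a b

open Gyrogroup

variable {G : Type u}

/-- A subgyrogroup: a nonempty subset closed under the operation and inverses. -/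
structure IsSubgyrogroup [Gyrogroup G] (H : Set G) : Prop where
  nonempty : H.Nonempty
  add_mem : ∀ ⦃a : G⦄, a ∈ H → ∀ ⦃b : G⦄, b ∈ H → a + b ∈ H
  neg_mem : ∀ ⦃a : G⦄, a ∈ H → -a ∈ H

/-- A gyrogroup homomorphism: a map preserving the operation. -/
def IsGyroHom [Gyrogroup G] {A : Type v} [Gyrogroup A] (φ : G → A) : Prop :=
  ∀ x y : G, φ (x + y) = φ x + φ y

/-- The kernel of a map into a gyrogroup. -/
def gyroKer [Gyrogroup G] {A : Type v} [Gyrogroup A] (φ : G → A) : Set G :=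
  {x : G | φ x = 0}

/-- A normal subgyrogroup: the kernel of some gyrogroup homomorphism from `G`. -/
def IsNormalSubgyrogroup [Gyrogroup G] (N : Set G) : Prop :=
  IsSubgyrogroup N ∧ ∃ (A : Type u) (instA : Gyrogroup A) (φ : G → A),
    @IsGyroHom G _ A instA φ ∧ N = @gyroKer G _ A instA φ

/-- The gyrocommutator `[a, b] = -(a + b) + gyr a b (b + a)`. -/
def gyroCommutator [Gyrogroup G] (a b : G) : G :=
  -(a + b) + gyr a b (b + a)

/-- The set of all gyrocommutators of `G`. -/
def gyroCommutatorSet (G : Type u) [Gyrogroup G] : Set G :=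
  {x : G | ∃ a b : G, x = gyroCommutator a b}

/-- `K` is the commutator subgyrogroup `G'` of `G`: the smallest subgyrogroup
containing all commutators. -/
def IsCommutatorSubgyrogroup [Gyrogroup G] (K : Set G) : Prop :=
  IsSubgyrogroup K ∧ gyroCommutatorSet G ⊆ K ∧
    ∀ H : Set G, IsSubgyrogroup H → gyroCommutatorSet G ⊆ H → K ⊆ H

/-- `K` is the normal closure `⟨⟨A⟩⟩` of `A`: the smallest normal subgyrogroup
containing `A`. -/
def IsGyroNormalClosure [Gyrogroup G] (A K : Set G) : Prop :=
  IsNormalSubgyrogroup K ∧ A ⊆ K ∧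
    ∀ N : Set G, IsNormalSubgyrogroup N → A ⊆ N → K ⊆ N

/-- The left coset `a ⊕ H`. -/
def lcoset [Gyrogroup G] (a : G) (H : Set G) : Set G := (a + ·) '' H

/-- The right coset `H ⊕ a`. -/
def rcoset [Gyrogroup G] (H : Set G) (a : G) : Set G := (· + a) '' H

/-- A gyrogroup is gyrocommutative if `a + b = gyr a b (b + a)` for all `a, b`. -/
def IsGyrocommutative (G : Type u) [Gyrogroup G] : Prop :=
  ∀ a b : G, a + b = gyr a b (b + a)

/-- An L-subgyrogroup: a subgyrogroup with `gyr a h (H) = H` for all `a ∈ G`, `h ∈ H`. -/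
def IsLSubgyrogroup [Gyrogroup G] (H : Set G) : Prop :=
  IsSubgyrogroup H ∧ ∀ a : G, ∀ h ∈ H, ⇑(gyr a h) '' H = H

/-- A subgroup of a gyrogroup: a subgyrogroup that forms a group under the gyrogroup
operation (equivalently, on which the operation is associative; together with the
closure properties and the identity and inverses inherited from `G`, this makes it
a group). -/
def IsSubgroupOfGyrogroup [Gyrogroup G] (H : Set G) : Prop :=
  IsSubgyrogroup H ∧ ∀ a ∈ H, ∀ b ∈ H, ∀ c ∈ H, a + (b + c) = (a + b) + c

/-- The left nucleus of `G`. -/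
def leftNucleus (G : Type u) [Gyrogroup G] : Set G :=
  {a : G | ∀ b c : G, a + (b + c) = (a + b) + c}

/-- The middle nucleus of `G`. -/
def middleNucleus (G : Type u) [Gyrogroup G] : Set G :=
  {b : G | ∀ a c : G, a + (b + c) = (a + b) + c}

/-- The right nucleus of `G`. -/
def rightNucleus (G : Type u) [Gyrogroup G] : Set G :=
  {c : G | ∀ a b : G, a + (b + c) = (a + b) + c}

/-- `L(G)`: the set of left gyrotranslations of `G`, viewed as permutations of `G`.
A permutation `σ` is a left gyrotranslation when `σ x = a + x` for some fixed `a`. -/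
def LSet (G : Type u) [Gyrogroup G] : Set (Equiv.Perm G) :=
  {σ : Equiv.Perm G | ∃ a : G, ∀ x : G, σ x = a + x}

/-- `L(H)` for a subset `H ⊆ G`: the left gyrotranslations by elements of `H`. -/
def LSetOf [Gyrogroup G] (H : Set G) : Set (Equiv.Perm G) :=
  {σ : Equiv.Perm G | ∃ a ∈ H, ∀ x : G, σ x = a + x}

/-- The left multiplication group `LMlt(G)`: the subgroup of `Sym(G)` generated by
the left gyrotranslations. -/
def LMlt (G : Type u) [Gyrogroup G] : Subgroup (Equiv.Perm G) :=
  Subgroup.closure (LSet G)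

/-- `L(G)'`: the set of products `L_{a₁} ∘ ⋯ ∘ L_{aₙ}` of left gyrotranslations whose
reversed product `L_{aₙ} ∘ ⋯ ∘ L_{a₁}` is the identity. -/
def LPrime (G : Type u) [Gyrogroup G] : Set (Equiv.Perm G) :=
  {σ : Equiv.Perm G | ∃ l : List (Equiv.Perm G),
    (∀ τ ∈ l, τ ∈ LSet G) ∧ σ = l.prod ∧ l.reverse.prod = 1}

/-- `L(G)^# = ⋂_{a ∈ G} L_a ∘ L(G)`. -/
def LSharp (G : Type u) [Gyrogroup G] : Set (Equiv.Perm G) :=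
  {σ : Equiv.Perm G | ∀ ρ ∈ LSet G, ∃ τ ∈ LSet G, σ = ρ * τ}

/-- The radical of `G`: elements whose left gyrotranslation lies in `L(G)'`. -/
def gyroRadical (G : Type u) [Gyrogroup G] : Set G :=
  {a : G | ∃ σ ∈ LPrime G, ∀ x : G, σ x = a + x}

/-- `X` is a normal subgroup of the subgroup `Γ` (as a subset of the ambient group). -/
def IsNormalSubgroupIn {M : Type v} [Group M] (Γ : Subgroup M) (X : Set M) : Prop :=
  X ⊆ (Γ : Set M) ∧ (1 : M) ∈ X ∧ (∀ σ ∈ X, σ⁻¹ ∈ X) ∧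
    (∀ σ ∈ X, ∀ τ ∈ X, σ * τ ∈ X) ∧ ∀ γ ∈ Γ, ∀ σ ∈ X, γ * σ * γ⁻¹ ∈ X

/-- The coaddition `a ⊞ b = a + gyr a (-b) b`. -/
def gyroCoadd [Gyrogroup G] (a b : G) : G := a + gyr a (-b) b

/-- Natural-number multiples: `0 • a = 0`, `(m+1) • a = a + m • a`. -/
def gyroNsmul [Gyrogroup G] : ℕ → G → G
  | 0, _ => 0
  | n + 1, a => a + gyroNsmul n a

/-- The index `[G : H]`: the number of left cosets of `H` in `G`. -/
noncomputable def gyroIndex [Gyrogroup G] (H : Set G) : ℕ :=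
  Set.ncard {S : Set G | ∃ a : G, S = lcoset a H}

namespace Gyrogroup

variable [Gyrogroup G]

theorem add_left_cancel' {a b c : G} (h : a + b = a + c) : b = c := by
  have h' : -a + (a + b) = -a + (a + c) := by rw [h]
  rw [add_gyr_assoc' (-a) a b, add_gyr_assoc' (-a) a c, neg_add', zero_add', zero_add'] at h'
  exact (gyr (-a) a).injective h'

theorem gyr_zero_left (a x : G) : gyr 0 a x = x := by
  have h := add_gyr_assoc' 0 a x
  rw [zero_add', zero_add'] at h
  exact (add_left_cancel' h).symm

theorem gyr_neg_self (a x : G) : gyr (-a) a x = x := by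
  rw [← left_loop' (-a) a, neg_add', gyr_zero_left]

theorem neg_add_cancel_left' (a b : G) : -a + (a + b) = b := by
  rw [add_gyr_assoc', neg_add', zero_add', gyr_neg_self]

theorem add_zero' (a : G) : a + 0 = a :=
  add_left_cancel' (a := -a) (by rw [neg_add_cancel_left', neg_add'])

theorem neg_neg' (a : G) : - -a = a := by
  have h := neg_add_cancel_left' (-a) a
  rwa [neg_add', add_zero'] at h

theorem eq_neg_of_add_eq_zero {a b : G} (h : a + b = 0) : a = -b := by
  have h' := neg_add_cancel_left' a b
  rw [h, add_zero'] at h'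
  rw [← h', neg_neg']

theorem gyr_apply_eq (a b c : G) : gyr a b c = -(a + b) + (a + (b + c)) := by
  rw [add_gyr_assoc' a, neg_add_cancel_left']

end Gyrogroup

namespace IsGyroHom

variable {A : Type v} [Gyrogroup G] [Gyrogroup A] {φ : G → A}

theorem map_zero (h : IsGyroHom φ) : φ 0 = 0 :=
  add_left_cancel' (a := φ 0) (by rw [← h, zero_add', add_zero'])

theorem map_neg (h : IsGyroHom φ) (a : G) : φ (-a) = -φ a :=
  eq_neg_of_add_eq_zero (by rw [← h, Gyrogroup.neg_add', h.map_zero])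

theorem map_gyr (h : IsGyroHom φ) (a b c : G) : φ (gyr a b c) = gyr (φ a) (φ b) (φ c) := by
  rw [gyr_apply_eq, gyr_apply_eq, h, h.map_neg, h, h, h]

theorem map_gyroCommutator (h : IsGyroHom φ) (a b : G) :
    φ (gyroCommutator a b) = gyroCommutator (φ a) (φ b) := by
  simp only [gyroCommutator]
  rw [h, h.map_neg, h.map_gyr, h, h]

theorem isSubgyrogroup_preimage (h : IsGyroHom φ) {H : Set A} (hH : IsSubgyrogroup H) :
    IsSubgyrogroup (φ ⁻¹' H) where
  nonempty := by
    obtain ⟨x, hx⟩ := hH.nonempty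
    refine ⟨0, ?_⟩
    rw [Set.mem_preimage, h.map_zero, ← Gyrogroup.neg_add' x]
    exact hH.add_mem (hH.neg_mem hx) hx
  add_mem a ha b hb := by
    rw [Set.mem_preimage, h]
    exact hH.add_mem ha hb
  neg_mem a ha := by
    rw [Set.mem_preimage, h.map_neg]
    exact hH.neg_mem ha

end IsGyroHom

/-- Every endomorphism maps the commutator subgyrogroup into itself. -/
theorem IsCommutatorSubgyrogroup.mapsTo [Gyrogroup G] {K : Set G}
    (hK : IsCommutatorSubgyrogroup K) {φ : G → G} (h : IsGyroHom φ) : Set.MapsTo φ K K := by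
  refine hK.2.2 _ (h.isSubgyrogroup_preimage hK.1) ?_
  rintro _ ⟨a, b, rfl⟩
  exact hK.2.1 ⟨φ a, φ b, h.map_gyroCommutator a b⟩

theorem isGyroHom_gyr [Gyrogroup G] (a b : G) : IsGyroHom (gyr a b) := gyr_add' a b

theorem isGyroHom_gyr_symm [Gyrogroup G] (a b : G) : IsGyroHom (gyr a b).symm := fun x y => by
  rw [Equiv.symm_apply_eq, gyr_add', Equiv.apply_symm_apply, Equiv.apply_symm_apply]

/-- the commutator subgyrogroup is an L-subgyrogroup:
`gyr a h (G') = G'` for all `a ∈ G` and `h ∈ G'`. -/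
theorem commutator_subgyrogroup_is_L_subgyrogroup [Gyrogroup G]
    (K : Set G) (hK : IsCommutatorSubgyrogroup K) :
    IsLSubgyrogroup K := by
  refine ⟨hK.1, fun a h _ => Set.Subset.antisymm (hK.mapsTo (isGyroHom_gyr a h)).image_subset ?_⟩
  intro x hx
  exact ⟨_, hK.mapsTo (isGyroHom_gyr_symm a h) hx, Equiv.apply_symm_apply _ x⟩
end

section
/- Let G be a gyrogroup. The left nucleus N_l(G) is a normal subgroup of G: it is a normal subgyrogroup of G (i.e., the kernel of some gyrogroup homomorphism from G) and forms a group under the operation ⊕ of G. -/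
universe u v

open Gyrogroup

variable {G : Type u}

section Basic

variable [Gyrogroup G]

theorem Gyrogroup.eq_of_add_eq (a : G) {u v : G} (h : a + u = a + v) : u = v := by
  have key : -a + (a + u) = -a + (a + v) := congrArg (-a + ·) h
  rw [add_gyr_assoc', add_gyr_assoc', neg_add', zero_add', zero_add'] at key
  exact (gyr (-a) a).injective key

theorem Gyrogroup.gyr_zero_left_s16 (a c : G) : gyr 0 a c = c := by
  have h := add_gyr_assoc' 0 a c
  rw [zero_add', zero_add'] at h
  exact (eq_of_add_eq a h).symm

theorem Gyrogroup.neg_add_cancel_left'_s16 (a c : G) : -a + (a + c) = c := by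
  rw [add_gyr_assoc', neg_add', zero_add', ← left_loop', neg_add', gyr_zero_left_s16]

theorem Gyrogroup.add_neg_cancel_left' (a c : G) : a + (-a + c) = c :=
  eq_of_add_eq (-a) (neg_add_cancel_left'_s16 a (-a + c))

theorem Gyrogroup.add_zero'_s16 (a : G) : a + 0 = a :=
  eq_of_add_eq (-a) ((neg_add_cancel_left'_s16 a 0).trans (neg_add' a).symm)

theorem Gyrogroup.add_neg' (a : G) : a + -a = 0 := by
  rw [← add_zero'_s16 (-a), add_neg_cancel_left']

theorem Gyrogroup.neg_neg'_s16 (a : G) : -(-a) = a :=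
  eq_of_add_eq (-a) ((add_neg' (-a)).trans (neg_add' a).symm)

theorem Gyrogroup.gyr_eq (a b c : G) : gyr a b c = -(a + b) + (a + (b + c)) := by
  rw [add_gyr_assoc' a b c, neg_add_cancel_left'_s16]

theorem Gyrogroup.gyr_gyr_cancel (a b c : G) : gyr b (a + b) (gyr a b c) = c := by
  have h : gyr b (a + b) = gyr (-a) (a + b) := by
    rw [← left_loop' (-a) (a + b), neg_add_cancel_left'_s16]
  rw [h, gyr_eq, ← add_gyr_assoc', neg_add_cancel_left'_s16, neg_add_cancel_left'_s16,
    neg_add_cancel_left'_s16]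

/-- The left Bol identity. -/
theorem Gyrogroup.left_bol (a b c : G) : a + (b + (a + c)) = (a + (b + a)) + c := by
  rw [add_gyr_assoc' b a c, add_gyr_assoc' a (b + a), gyr_gyr_cancel]

end Basic

section Quotient

variable [Gyrogroup G] (r : AddCon G)

theorem AddCon.gyro_neg {x y : G} (h : r x y) : r (-x) (-y) := by
  have hxy : r (-x + (y + -y)) (-x + (x + -y)) :=
    r.add (r.refl _) (r.add (r.symm h) (r.refl _))
  rwa [Gyrogroup.add_neg', add_zero'_s16, neg_add_cancel_left'_s16] at hxy

/-- Negation on the quotient of a gyrogroup by a congruence. -/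
def AddCon.gyroNeg : r.Quotient → r.Quotient :=
  Quotient.map' (fun x : G ↦ -x) (fun _ _ h ↦ r.gyro_neg h)

/-- Left translation by an element of the quotient of a gyrogroup by a congruence. -/
def AddCon.gyroTranslation (a : r.Quotient) : r.Quotient ≃ r.Quotient where
  toFun x := a + x
  invFun x := r.gyroNeg a + x
  left_inv x := by
    induction a, x using AddCon.induction_on₂ with
    | _ a x => exact congrArg _ (neg_add_cancel_left'_s16 a x)
  right_inv x := by
    induction a, x using AddCon.induction_on₂ with
    | _ a x => exact congrArg _ (add_neg_cancel_left' a x)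

/-- The gyrations of the quotient of a gyrogroup by a congruence. -/
def AddCon.quotientGyr (a b : r.Quotient) : r.Quotient ≃ r.Quotient :=
  ((r.gyroTranslation b).trans (r.gyroTranslation a)).trans (r.gyroTranslation (a + b)).symm

theorem AddCon.quotientGyr_coe (a b c : G) :
    r.quotientGyr (a : r.Quotient) (b : r.Quotient) (c : r.Quotient) =
      (gyr a b c : G) :=
  congrArg ((↑) : G → r.Quotient) (gyr_eq a b c).symm

/-- The quotient of a gyrogroup by a congruence is a gyrogroup. -/
abbrev AddCon.quotientGyrogroup : Gyrogroup r.Quotient where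
  zero := ((0 : G) : r.Quotient)
  neg := r.gyroNeg
  zero_add' a := by
    induction a using AddCon.induction_on with
    | _ a => exact congrArg _ (Gyrogroup.zero_add' a)
  neg_add' a := by
    induction a using AddCon.induction_on with
    | _ a => exact congrArg _ (Gyrogroup.neg_add' a)
  gyr := r.quotientGyr
  gyr_add' a b x y := by
    induction a, b using AddCon.induction_on₂ with
    | _ a b =>
      induction x, y using AddCon.induction_on₂ with
      | _ x y =>
        rw [← AddCon.coe_add, quotientGyr_coe, quotientGyr_coe, quotientGyr_coe, gyr_add',
          AddCon.coe_add]
  add_gyr_assoc' a b c := by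
    induction a, b using AddCon.induction_on₂ with
    | _ a b =>
      induction c using AddCon.induction_on with
      | _ c =>
        rw [quotientGyr_coe]
        exact congrArg _ (add_gyr_assoc' a b c)
  left_loop' a b := by
    ext c
    induction a, b using AddCon.induction_on₂ with
    | _ a b =>
      induction c using AddCon.induction_on with
      | _ c => rw [← AddCon.coe_add, quotientGyr_coe, quotientGyr_coe, left_loop']

end Quotient

section LeftNucleus

variable [Gyrogroup G]

theorem neg_mem_leftNucleus {n : G} (hn : n ∈ leftNucleus G) : -n ∈ leftNucleus G := by
  intro b c
  apply eq_of_add_eq n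
  rw [add_neg_cancel_left', hn, add_neg_cancel_left']

theorem add_mem_leftNucleus {m n : G} (hm : m ∈ leftNucleus G) (hn : n ∈ leftNucleus G) :
    m + n ∈ leftNucleus G := by
  intro b c
  rw [← hm n (b + c), hn, hm, hm n b]

theorem isSubgyrogroup_leftNucleus : IsSubgyrogroup (leftNucleus G) where
  nonempty := ⟨0, fun b c ↦ by rw [zero_add', zero_add']⟩
  add_mem _ ha _ hb := add_mem_leftNucleus ha hb
  neg_mem _ ha := neg_mem_leftNucleus ha

theorem leftNucleus_subset_middleNucleus : leftNucleus G ⊆ middleNucleus G := by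
  intro n hn a c
  have key : ∀ c, a + (n + c) = -(-n + -a) + c := fun c ↦ by
    apply eq_of_add_eq (-n + -a)
    rw [add_neg_cancel_left', ← neg_mem_leftNucleus hn, neg_add_cancel_left'_s16,
      neg_add_cancel_left'_s16]
  rw [key c, ← add_zero'_s16 n, key 0, add_zero'_s16, add_zero'_s16]

theorem middleNucleus_subset_leftNucleus : middleNucleus G ⊆ leftNucleus G := by
  intro n hn
  rw [← neg_neg'_s16 n]
  refine neg_mem_leftNucleus fun a c ↦ ?_
  have key : ∀ c, -n + (a + c) = -(-a + n) + c := fun c ↦ by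
    apply eq_of_add_eq (-a + n)
    rw [add_neg_cancel_left', ← hn, add_neg_cancel_left', neg_add_cancel_left'_s16]
  rw [key c, ← add_zero'_s16 a, key 0, add_zero'_s16, add_zero'_s16]

theorem leftNucleus_eq_middleNucleus : leftNucleus G = middleNucleus G :=
  leftNucleus_subset_middleNucleus.antisymm middleNucleus_subset_leftNucleus

theorem add_conj_add {m : G} (hm : m ∈ leftNucleus G) (a x c : G) :
    a + (x + (m + (-x + c))) = (a + (x + (m + -x))) + c := by
  have key : ∀ c, a + (x + (m + (-x + c))) = (-x + (((x + (a + x)) + m) + -x)) + c :=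
    fun c ↦ by
      apply eq_of_add_eq x
      rw [left_bol, leftNucleus_subset_middleNucleus hm, ← left_bol (-x), add_neg_cancel_left']
  rw [key c, ← add_zero'_s16 (-x), key 0, add_zero'_s16, add_zero'_s16]

theorem conj_add {m : G} (hm : m ∈ leftNucleus G) (x c : G) :
    (x + (m + -x)) + c = x + (m + (-x + c)) := by
  simpa only [zero_add'] using (add_conj_add hm 0 x c).symm

theorem conj_mem_leftNucleus {m : G} (hm : m ∈ leftNucleus G) (x : G) :
    x + (m + -x) ∈ leftNucleus G :=
  middleNucleus_subset_leftNucleus fun a c ↦ by rw [conj_add hm, add_conj_add hm]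

variable (G) in
/-- The congruence whose classes are the right cosets of the left nucleus. -/
def leftNucleusCon : AddCon G where
  r x y := ∃ n ∈ leftNucleus G, n + y = x
  iseqv :=
    { refl := fun x ↦ ⟨0, fun b c ↦ by rw [zero_add', zero_add'], zero_add' x⟩
      symm := by
        rintro _ y ⟨n, hn, rfl⟩
        exact ⟨-n, neg_mem_leftNucleus hn, neg_add_cancel_left'_s16 n y⟩
      trans := by
        rintro _ _ z ⟨m, hm, rfl⟩ ⟨n, hn, rfl⟩
        exact ⟨m + n, add_mem_leftNucleus hm hn, (hm n z).symm⟩ }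
  add' := by
    rintro _ x _ y ⟨n, hn, rfl⟩ ⟨m, hm, rfl⟩
    have hc := conj_mem_leftNucleus hm x
    refine ⟨n + (x + (m + -x)), add_mem_leftNucleus hn hc, ?_⟩
    rw [← hn, hc, conj_add hm, Gyrogroup.neg_add', add_zero'_s16, ← hn,
      leftNucleus_subset_middleNucleus hm]

theorem isNormalSubgyrogroup_leftNucleus : IsNormalSubgyrogroup (leftNucleus G) := by
  refine ⟨isSubgyrogroup_leftNucleus, (leftNucleusCon G).Quotient,
    (leftNucleusCon G).quotientGyrogroup, fun x ↦ x, fun _ _ ↦ rfl, ?_⟩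
  ext x
  refine Iff.trans ?_ ((leftNucleusCon G).eq (a := x) (b := 0)).symm
  constructor
  · exact fun hx ↦ ⟨x, hx, add_zero'_s16 x⟩
  · rintro ⟨n, hn, rfl⟩
    rwa [add_zero'_s16]

end LeftNucleus

/-- the left nucleus is a normal subgroup of `G`: it is a normal
subgyrogroup (the kernel of some gyrogroup homomorphism from `G`) and forms a group
under the operation of `G`. -/
theorem leftNucleus_normal_subgroup (G : Type u) [Gyrogroup G] :
    IsNormalSubgyrogroup (leftNucleus G) ∧ IsSubgroupOfGyrogroup (leftNucleus G) := by
  exact ⟨isNormalSubgyrogroup_leftNucleus, isSubgyrogroup_leftNucleus,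
    fun _ ha b _ c _ ↦ ha b c⟩
end
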